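/- arXiv:2002.09161 — 4 statements merged into one kernel-verified Lean document; each statement's English description precedes it below -/
import Mathlib

section
/- Under the setting of the cycle-consistency decomposition (encoder joint p_e(x,z) = p_r(x)·e(z|x) and generator joint p_g(x,z) = p_z(z)·g(x|z), all densities strictly positive, all relevant integrals existing), the cycle-consistency objective L_CC := −∫∫ p_e(x,z) log g(x|z) d(μ⊗ν) satisfies L_CC ≤ D_KL(p_e, p_g) − ∫ p_r(x) log p_r(x) dμ(x). -/
open MeasureTheory

theorem stmt8 {X Z : Type*} [MeasurableSpace X] [MeasurableSpace Z]
    (μ : Measure X) (ν : Measure Z) [SigmaFinite μ] [SigmaFinite ν]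
    (pr : X → ℝ) (e : X → Z → ℝ) (pz : Z → ℝ) (g : Z → X → ℝ)
    (hprm : Measurable pr) (hem : Measurable (Function.uncurry e))
    (hpzm : Measurable pz) (hgm : Measurable (Function.uncurry g))
    (hpr0 : ∀ x, 0 < pr x) (he0 : ∀ x z, 0 < e x z)
    (hpz0 : ∀ z, 0 < pz z) (hg0 : ∀ z x, 0 < g z x)
    (hpr1 : ∫ x, pr x ∂μ = 1) (hpz1 : ∫ z, pz z ∂ν = 1)
    (he1 : ∀ x, ∫ z, e x z ∂ν = 1) (hg1 : ∀ z, ∫ x, g z x ∂μ = 1)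
    (pe pg : X × Z → ℝ)
    (hpe : ∀ x z, pe (x, z) = pr x * e x z)
    (hpg : ∀ x z, pg (x, z) = pz z * g z x)
    (hint1 : Integrable (fun w => pe w * Real.log (pe w / pg w)) (μ.prod ν))
    (hint2 : Integrable (fun w => pe w * Real.log (g w.2 w.1)) (μ.prod ν))
    (hint3 : ∀ x, Integrable (fun z => e x z * Real.log (e x z / pz z)) ν)
    (hint4 : Integrable (fun x => pr x * ∫ z, e x z * Real.log (e x z / pz z) ∂ν) μ)
    (hint5 : Integrable (fun x => pr x * Real.log (pr x)) μ) :
    -(∫ w, pe w * Real.log (g w.2 w.1) ∂(μ.prod ν))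
      ≤ ∫ w, pe w * Real.log (pe w / pg w) ∂(μ.prod ν)
        - ∫ x, pr x * Real.log (pr x) ∂μ := by
  have hei : ∀ x, Integrable (fun z => e x z) ν := fun x => by
    by_contra h
    have := he1 x
    rw [integral_undef h] at this
    exact zero_ne_one this
  have hpzi : Integrable pz ν := by
    by_contra h
    rw [integral_undef h] at hpz1
    exact zero_ne_one hpz1
  have hK : ∀ x, 0 ≤ ∫ z, e x z * Real.log (e x z / pz z) ∂ν := fun x => by
    have h1 : ∫ z, (e x z - pz z) ∂ν = 0 := by
      rw [integral_sub (hei x) hpzi, he1 x, hpz1, sub_self]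
    rw [← h1]
    refine integral_mono ((hei x).sub hpzi) (hint3 x) (fun z => ?_)
    have he := he0 x z
    have hp := hpz0 z
    have h2 := Real.log_le_sub_one_of_pos (div_pos hp he)
    rw [Real.log_div hp.ne' he.ne'] at h2
    have h3 := mul_le_mul_of_nonneg_left h2 he.le
    have h4 : e x z * (pz z / e x z - 1) = pz z - e x z := by
      field_simp
    show e x z - pz z ≤ e x z * Real.log (e x z / pz z)
    rw [Real.log_div he.ne' hp.ne']
    nlinarith
  have hsum := integral_add hint1 hint2
  have hfub := integral_prod _ (hint1.add hint2)
  have hinner : ∀ x, ∫ z, (((fun w => pe w * Real.log (pe w / pg w)) +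
      (fun w => pe w * Real.log (g w.2 w.1))) : X × Z → ℝ) (x, z) ∂ν
      = pr x * Real.log (pr x) + pr x * ∫ z, e x z * Real.log (e x z / pz z) ∂ν := fun x => by
    have h1 : ∀ z, (((fun w => pe w * Real.log (pe w / pg w)) +
      (fun w => pe w * Real.log (g w.2 w.1))) : X × Z → ℝ) (x, z)
      = (pr x * Real.log (pr x)) * e x z + pr x * (e x z * Real.log (e x z / pz z)) := fun z => by
      have a := (hpr0 x).ne'
      have b := (he0 x z).ne'
      have c := (hpz0 z).ne'
      have d := (hg0 z x).ne'
      simp only [Pi.add_apply, hpe, hpg]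
      rw [Real.log_div (mul_ne_zero a b) (mul_ne_zero c d), Real.log_mul a b, Real.log_mul c d,
        Real.log_div b c]
      ring
    simp_rw [h1]
    rw [integral_add ((hei x).const_mul _) ((hint3 x).const_mul _), integral_const_mul,
      integral_const_mul, he1 x, mul_one]
  simp_rw [hinner] at hfub
  rw [integral_add hint5 hint4] at hfub
  have hnn : 0 ≤ ∫ x, pr x * ∫ z, e x z * Real.log (e x z / pz z) ∂ν ∂μ :=
    integral_nonneg fun x => mul_nonneg (hpr0 x).le (hK x)
  simp only [Pi.add_apply] at hfub
  linarith
end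

section
/- Let f : (0,∞) → ℝ be twice continuously differentiable with f(1) = 0, and define f̃(u) = u·f(1/u). Let p, q : ℝⁿ → ℝ be strictly positive continuously differentiable probability densities, let g : ℝⁿ → ℝⁿ be continuously differentiable with compact support, and let (q_t)_{t∈(−ε,ε)} be a family of strictly positive densities with q_0 = q such that for every y, t ↦ q_t(y) is differentiable at 0 with (∂/∂t) q_t(y)|_{t=0} = −⟨∇q(y), g(y)⟩ − q(y)·(div g)(y). Set r(y) = p(y)/q(y) and 𝒟(y) = log r(y). Assume differentiation under the integral sign is valid at t = 0 for ∫ q_t(y) f(p(y)/q_t(y)) dy (e.g., the t-difference quotients of the integrand are dominated by an integrable function), and that y ↦ q(y) s(y) ⟨∇𝒟(y), g(y)⟩ is integrable, where s(y) = f̃''(1/r(y))/r(y). Then (d/dt) ∫ q_t(y) f(p(y)/q_t(y)) dy |_{t=0} = −∫ q(y) s(y) ⟨∇𝒟(y), g(y)⟩ dy. -/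
open MeasureTheory RealInnerProductSpace

/-- `f̃(u) = u · f(1/u)`. -/
noncomputable def ftilde (f : ℝ → ℝ) (u : ℝ) : ℝ := u * f (1 / u)

theorem stmt13 (n : ℕ) (f f' f'' ft' ft'' : ℝ → ℝ)
    (hf1 : f 1 = 0)
    (hf' : ∀ u : ℝ, 0 < u → HasDerivAt f (f' u) u)
    (hf'' : ∀ u : ℝ, 0 < u → HasDerivAt f' (f'' u) u)
    (hf''c : ContinuousOn f'' (Set.Ioi 0))
    (hft' : ∀ u : ℝ, 0 < u → HasDerivAt (ftilde f) (ft' u) u)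
    (hft'' : ∀ u : ℝ, 0 < u → HasDerivAt ft' (ft'' u) u)
    (p q : EuclideanSpace ℝ (Fin n) → ℝ)
    (hp : ContDiff ℝ 1 p) (hq : ContDiff ℝ 1 q)
    (hp0 : ∀ y, 0 < p y) (hq0 : ∀ y, 0 < q y)
    (hp1 : ∫ y, p y = 1) (hq1 : ∫ y, q y = 1)
    (g : EuclideanSpace ℝ (Fin n) → EuclideanSpace ℝ (Fin n))
    (hg : ContDiff ℝ 1 g) (hgsupp : HasCompactSupport g)
    (ε : ℝ) (hε : 0 < ε)
    (qt : ℝ → EuclideanSpace ℝ (Fin n) → ℝ)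
    (hqt0 : ∀ y, qt 0 y = q y)
    (hqtpos : ∀ t : ℝ, |t| < ε → ∀ y, 0 < qt t y)
    (hqt1 : ∀ t : ℝ, |t| < ε → ∫ y, qt t y = 1)
    (hdyn : ∀ y, HasDerivAt (fun t => qt t y)
      (-⟪gradient q y, g y⟫ - q y * ∑ j, fderiv ℝ g y (EuclideanSpace.single j 1) j) 0)
    (hDUI : HasDerivAt (fun t => ∫ y, qt t y * f (p y / qt t y))
      (∫ y, deriv (fun t => qt t y * f (p y / qt t y)) 0) 0)
    (hint : Integrable (fun y =>
      q y * (ft'' (1 / (p y / q y)) / (p y / q y)) *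
        ⟪gradient (fun y' => Real.log (p y' / q y')) y, g y⟫)) :
    HasDerivAt (fun t => ∫ y, qt t y * f (p y / qt t y))
      (-∫ y, q y * (ft'' (1 / (p y / q y)) / (p y / q y)) *
          ⟪gradient (fun y' => Real.log (p y' / q y')) y, g y⟫) 0 := by
  have hr0 : ∀ y, 0 < p y / q y := fun y => div_pos (hp0 y) (hq0 y)
  have hrC : ContDiff ℝ 1 (fun y => p y / q y) := hp.div hq (fun y => (hq0 y).ne')
  have hft1 : ∀ u : ℝ, 0 < u → ft' u = f (1 / u) - f' (1 / u) / u := by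
    intro u hu
    have h1 : HasDerivAt (fun u : ℝ => 1 / u) (-(u ^ 2)⁻¹) u := by
      simpa using hasDerivAt_inv hu.ne'
    have h2 := (hasDerivAt_id u).mul
      (HasDerivAt.comp u (hf' (1 / u) (by positivity)) h1)
    have h3 := (hft' u hu).unique h2
    rw [h3]
    simp only [id, Function.comp]
    field_simp
    ring
  have hft2 : ∀ u : ℝ, 0 < u → ft'' u = f'' (1 / u) / u ^ 3 := by
    intro u hu
    have h1 : HasDerivAt (fun u : ℝ => 1 / u) (-(u ^ 2)⁻¹) u := by
      simpa using hasDerivAt_inv hu.ne'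
    have ha := HasDerivAt.comp u (hf' (1 / u) (by positivity)) h1
    have hb := HasDerivAt.comp u (hf'' (1 / u) (by positivity)) h1
    have h2 := ha.sub (hb.div (hasDerivAt_id u) hu.ne')
    have h3 : HasDerivAt ft' _ u := h2.congr_of_eventuallyEq (by
      filter_upwards [lt_mem_nhds hu] with v hv
      simp [hft1 v hv])
    rw [(hft'' u hu).unique h3]
    simp only [id, Function.comp]
    field_simp
    ring
  set h : EuclideanSpace ℝ (Fin n) → ℝ :=
    fun y => f (p y / q y) - (p y / q y) * f' (p y / q y) with hh
  have hhD : ∀ y, HasFDerivAt h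
      ((-(p y / q y * f'' (p y / q y))) • fderiv ℝ (fun y => p y / q y) y) y := by
    intro y
    have h1 : HasDerivAt (fun u => f u - u * f' u)
        (-(p y / q y * f'' (p y / q y))) (p y / q y) := by
      have := (hf' _ (hr0 y)).sub ((hasDerivAt_id _).mul (hf'' _ (hr0 y)))
      refine this.congr_deriv ?_
      simp
    exact h1.comp_hasFDerivAt y ((hrC.differentiable one_ne_zero) y).hasFDerivAt
  have hhC : ContDiff ℝ 1 h := by
    rw [contDiff_one_iff_hasFDerivAt]
    refine ⟨_, ?_, hhD⟩
    have hc : Continuous (fun y => f'' (p y / q y)) :=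
      hf''c.comp_continuous hrC.continuous (fun y => hr0 y)
    exact ((hrC.continuous.mul hc).neg).smul (hrC.continuous_fderiv one_ne_zero)
  let w : Fin n → EuclideanSpace ℝ (Fin n) → ℝ := fun j y => q y * g y j
  have hgj : ∀ j, ContDiff ℝ 1 (fun y => g y j) := fun j => by fun_prop
  have hwC : ∀ j, ContDiff ℝ 1 (w j) := fun j => hq.mul (hgj j)
  have hws : ∀ j, HasCompactSupport (w j) := by
    intro j
    refine hgsupp.mono ?_
    intro y hy hy0
    exact hy (by simp [w, hy0])
  let e : Fin n → EuclideanSpace ℝ (Fin n) := fun j => EuclideanSpace.single j 1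
  have hwD : ∀ j y, fderiv ℝ (w j) y (e j)
      = fderiv ℝ q y (e j) * g y j + q y * fderiv ℝ g y (e j) j := by
    intro j y
    have h1 := (hq.differentiable one_ne_zero y).hasFDerivAt
    have h2 := (hg.differentiable one_ne_zero y).hasFDerivAt
    have h3 : HasFDerivAt (fun y => g y j)
        ((EuclideanSpace.proj j : EuclideanSpace ℝ (Fin n) →L[ℝ] ℝ).comp (fderiv ℝ g y)) y :=
      (EuclideanSpace.proj j : EuclideanSpace ℝ (Fin n) →L[ℝ] ℝ).hasFDerivAt.comp y h2
    have h4 : HasFDerivAt (w j) _ y := h1.mul h3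
    rw [h4.fderiv]
    simp
    ring
  have hI1 : ∀ j, Integrable (fun y => h y * fderiv ℝ (w j) y (e j)) := by
    intro j
    refine Continuous.integrable_of_hasCompactSupport ?_ ?_
    · exact hhC.continuous.mul (((hwC j).continuous_fderiv one_ne_zero).clm_apply continuous_const)
    · exact ((hws j).fderiv_apply ℝ (e j)).mul_left
  have hI2 : ∀ j, Integrable (fun y => fderiv ℝ h y (e j) * w j y) := by
    intro j
    refine Continuous.integrable_of_hasCompactSupport ?_ ?_
    · exact ((hhC.continuous_fderiv one_ne_zero).clm_apply continuous_const).mul (hwC j).continuous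
    · exact (hws j).mul_left
  have hI3 : ∀ j, Integrable (fun y => h y * w j y) := by
    intro j
    refine Continuous.integrable_of_hasCompactSupport ?_ ?_
    · exact hhC.continuous.mul (hwC j).continuous
    · exact (hws j).mul_left
  have hIBP : ∀ j, ∫ y, h y * fderiv ℝ (w j) y (e j) = -∫ y, fderiv ℝ h y (e j) * w j y :=
    fun j => integral_mul_fderiv_eq_neg_fderiv_mul_of_integrable (hI2 j) (hI1 j) (hI3 j)
      (fun y _ => hhC.differentiable one_ne_zero y) (fun y _ => (hwC j).differentiable one_ne_zero y)
  have hgsum : ∀ y, g y = ∑ j, g y j • e j := by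
    intro y
    ext i
    simp [e, Finset.sum_apply, Pi.single_apply]
  have hLsum : ∀ (L : EuclideanSpace ℝ (Fin n) →L[ℝ] ℝ) y, L (g y) = ∑ j, L (e j) * g y j := by
    intro L y
    conv_lhs => rw [hgsum y]
    simp [mul_comm]
  have hgrad : ∀ (F : EuclideanSpace ℝ (Fin n) → ℝ) y v, ⟪gradient F y, v⟫ = fderiv ℝ F y v := by
    intro F y v
    simp [gradient]
  have hA : ∀ y, deriv (fun t => qt t y * f (p y / qt t y)) 0
      = -∑ j, h y * fderiv ℝ (w j) y (e j) := by
    intro y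
    have h1 := hdyn y
    have hq0' : qt 0 y ≠ 0 := by rw [hqt0]; exact (hq0 y).ne'
    have h2 := (hasDerivAt_const (0:ℝ) (p y)).div h1 hq0'
    have h3 : HasDerivAt f (f' (p y / q y)) (p y / qt 0 y) := by
      rw [hqt0]; exact hf' _ (hr0 y)
    have h4 := h1.mul (HasDerivAt.comp (0:ℝ) h3 h2)
    have h5 : deriv (fun t => qt t y * f (p y / qt t y)) 0 = _ := h4.deriv
    rw [h5]
    simp only [hwD, Function.comp, ← Finset.mul_sum, Finset.sum_add_distrib, hgrad, hLsum, hqt0, hh, Pi.div_apply]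
    have := (hq0 y).ne'
    simp only [e]
    field_simp
    ring
  have hB : ∀ y, ∑ j, fderiv ℝ h y (e j) * w j y
      = -(q y * (ft'' (1 / (p y / q y)) / (p y / q y)) *
          ⟪gradient (fun y' => Real.log (p y' / q y')) y, g y⟫) := by
    intro y
    have h1 : fderiv ℝ (fun y' => Real.log (p y' / q y')) y
        = (p y / q y)⁻¹ • fderiv ℝ (fun y => p y / q y) y :=
      (((hrC.differentiable one_ne_zero) y).hasFDerivAt.log (hr0 y).ne').fderiv
    have h2 : ∑ j, fderiv ℝ h y (e j) * w j y = q y * fderiv ℝ h y (g y) := by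
      rw [hLsum, Finset.mul_sum]
      refine Finset.sum_congr rfl fun j _ => ?_
      simp only [w]; ring
    rw [h2, hgrad, h1, (hhD y).fderiv, hft2 _ (one_div_pos.2 (hr0 y))]
    simp only [ContinuousLinearMap.smul_apply, smul_eq_mul, one_div_one_div]
    generalize fderiv ℝ (fun y => p y / q y) y (g y) = d
    have := hr0 y
    generalize p y / q y = r at *
    field_simp
  refine hDUI.congr_deriv ?_
  simp only [hA]
  rw [integral_neg, integral_finset_sum _ (fun j _ => hI1 j)]
  simp only [hIBP]
  rw [Finset.sum_neg_distrib, ← integral_finset_sum _ (fun j _ => hI2 j)]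
  simp only [hB]
  rw [integral_neg, neg_neg]
end

section
/- Let f : (0,∞) → ℝ be twice continuously differentiable with f(1) = 0. Let p, q : ℝⁿ → ℝ be strictly positive continuously differentiable probability densities, let e : ℝⁿ → ℝⁿ be continuously differentiable with compact support, and let (p_t)_{t∈(−ε,ε)} be a family of strictly positive densities with p_0 = p such that for every y, t ↦ p_t(y) is differentiable at 0 with (∂/∂t) p_t(y)|_{t=0} = −⟨∇p(y), e(y)⟩ − p(y)·(div e)(y). Set r(y) = p(y)/q(y) and 𝒟(y) = log r(y). Assume differentiation under the integral sign is valid at t = 0 for ∫ q(y) f(p_t(y)/q(y)) dy, and that y ↦ p(y) s(y) ⟨∇𝒟(y), e(y)⟩ is integrable, where s(y) = f''(r(y))·r(y). Then (d/dt) ∫ q(y) f(p_t(y)/q(y)) dy |_{t=0} = ∫ p(y) s(y) ⟨∇𝒟(y), e(y)⟩ dy. -/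
open MeasureTheory RealInnerProductSpace

lemma aux_grad {n : ℕ} (h : EuclideanSpace ℝ (Fin n) → ℝ) (y v : EuclideanSpace ℝ (Fin n)) :
    ⟪gradient h y, v⟫ = fderiv ℝ h y v := by
  simp [gradient]

lemma aux_sum {n : ℕ} (L : EuclideanSpace ℝ (Fin n) →L[ℝ] ℝ) (v : EuclideanSpace ℝ (Fin n)) :
    L v = ∑ j, L (EuclideanSpace.single j 1) * v j := by
  have h := (EuclideanSpace.basisFun (Fin n) ℝ).sum_repr v
  conv_lhs => rw [← h]
  simp [map_sum, mul_comm]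

theorem stmt14 (n : ℕ) (f f' f'' : ℝ → ℝ)
    (hf1 : f 1 = 0)
    (hf' : ∀ u : ℝ, 0 < u → HasDerivAt f (f' u) u)
    (hf'' : ∀ u : ℝ, 0 < u → HasDerivAt f' (f'' u) u)
    (hf''c : ContinuousOn f'' (Set.Ioi 0))
    (p q : EuclideanSpace ℝ (Fin n) → ℝ)
    (hp : ContDiff ℝ 1 p) (hq : ContDiff ℝ 1 q)
    (hp0 : ∀ y, 0 < p y) (hq0 : ∀ y, 0 < q y)
    (hp1 : ∫ y, p y = 1) (hq1 : ∫ y, q y = 1)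
    (e : EuclideanSpace ℝ (Fin n) → EuclideanSpace ℝ (Fin n))
    (he : ContDiff ℝ 1 e) (hesupp : HasCompactSupport e)
    (ε : ℝ) (hε : 0 < ε)
    (pt : ℝ → EuclideanSpace ℝ (Fin n) → ℝ)
    (hpt0 : ∀ y, pt 0 y = p y)
    (hptpos : ∀ t : ℝ, |t| < ε → ∀ y, 0 < pt t y)
    (hpt1 : ∀ t : ℝ, |t| < ε → ∫ y, pt t y = 1)
    (hdyn : ∀ y, HasDerivAt (fun t => pt t y)
      (-⟪gradient p y, e y⟫ - p y * ∑ j, fderiv ℝ e y (EuclideanSpace.single j 1) j) 0)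
    (hDUI : HasDerivAt (fun t => ∫ y, q y * f (pt t y / q y))
      (∫ y, deriv (fun t => q y * f (pt t y / q y)) 0) 0)
    (hint : Integrable (fun y =>
      p y * (f'' (p y / q y) * (p y / q y)) *
        ⟪gradient (fun y' => Real.log (p y' / q y')) y, e y⟫)) :
    HasDerivAt (fun t => ∫ y, q y * f (pt t y / q y))
      (∫ y, p y * (f'' (p y / q y) * (p y / q y)) *
          ⟪gradient (fun y' => Real.log (p y' / q y')) y, e y⟫) 0 := by
  have hr0 : ∀ y, 0 < p y / q y := fun y => div_pos (hp0 y) (hq0 y)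
  have hr : ContDiff ℝ 1 (fun y => p y / q y) := hp.div hq (fun y => (hq0 y).ne')
  have hrd : ∀ y, HasFDerivAt (fun y => p y / q y) (fderiv ℝ (fun y => p y / q y) y) y :=
    fun y => (hr.differentiable one_ne_zero y).hasFDerivAt
  have had : ∀ y, HasFDerivAt (fun y => f' (p y / q y))
      (f'' (p y / q y) • fderiv ℝ (fun y => p y / q y) y) y :=
    fun y => (hf'' _ (hr0 y)).comp_hasFDerivAt y (hrd y)
  have hac : Continuous (fun y => f' (p y / q y)) :=
    continuous_iff_continuousAt.2 fun y => (had y).continuousAt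
  have hf''rc : Continuous (fun y => f'' (p y / q y)) :=
    hf''c.comp_continuous hr.continuous hr0
  have hrdc : Continuous (fderiv ℝ (fun y => p y / q y)) := hr.continuous_fderiv one_ne_zero
  have hed : ∀ y, HasFDerivAt e (fderiv ℝ e y) y :=
    fun y => (he.differentiable one_ne_zero y).hasFDerivAt
  have hej : ∀ j, ContDiff ℝ 1 (fun y => e y j) := fun j => contDiff_euclidean.1 he j
  have hejd : ∀ j y v, fderiv ℝ (fun y => e y j) y v = fderiv ℝ e y v j := by
    intro j y v
    have := ((EuclideanSpace.proj j : EuclideanSpace ℝ (Fin n) →L[ℝ] ℝ).hasFDerivAt.comp y (hed y)).fderiv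
    exact congrArg (fun L => L v) this
  have hg : ∀ j, ContDiff ℝ 1 (fun y => p y * e y j) := fun j => hp.mul (hej j)
  have hejs : ∀ j, HasCompactSupport (fun y => e y j) := fun j =>
    hesupp.comp_left (g := fun v : EuclideanSpace ℝ (Fin n) => v j) rfl
  have hgs : ∀ j, HasCompactSupport (fun y => p y * e y j) := fun j => (hejs j).mul_left
  have hgd : ∀ j y v, fderiv ℝ (fun y => p y * e y j) y v
      = fderiv ℝ p y v * e y j + p y * fderiv ℝ e y v j := by
    intro j y v
    rw [fderiv_fun_mul (hp.differentiable one_ne_zero y) ((hej j).differentiable one_ne_zero y)]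
    simp [hejd]; ring
  have hI1 : ∀ j, Integrable (fun y => (f'' (p y / q y) • fderiv ℝ (fun y => p y / q y) y)
      (EuclideanSpace.single j 1) * (p y * e y j)) := by
    intro j
    refine Continuous.integrable_of_hasCompactSupport ?_ (hgs j).mul_left
    exact ((hf''rc.smul hrdc).clm_apply continuous_const).mul (hg j).continuous
  have hI2 : ∀ j, Integrable (fun y => f' (p y / q y) *
      fderiv ℝ (fun y => p y * e y j) y (EuclideanSpace.single j 1)) := by
    intro j
    refine Continuous.integrable_of_hasCompactSupport ?_ ?_
    · exact hac.mul (((hg j).continuous_fderiv one_ne_zero).clm_apply continuous_const)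
    · exact ((hgs j).fderiv_apply (𝕜 := ℝ) _).mul_left
  have hI3 : ∀ j, Integrable (fun y => f' (p y / q y) * (p y * e y j)) := by
    intro j
    exact Continuous.integrable_of_hasCompactSupport (hac.mul (hg j).continuous) (hgs j).mul_left
  have hparts : ∀ j, ∫ y, f' (p y / q y) *
      fderiv ℝ (fun y => p y * e y j) y (EuclideanSpace.single j 1) =
      - ∫ y, (f'' (p y / q y) • fderiv ℝ (fun y => p y / q y) y)
      (EuclideanSpace.single j 1) * (p y * e y j) := by
    intro j
    exact integral_bilinear_hasFDerivAt_right_eq_neg_left_of_integrable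
      (B := ContinuousLinearMap.mul ℝ ℝ) (hI1 j) (hI2 j) (hI3 j) (fun y _ => had y)
      (fun y _ => ((hg j).differentiable one_ne_zero y).hasFDerivAt)
  have hL : ∀ y, deriv (fun t => q y * f (pt t y / q y)) 0 =
      - ∑ j, f' (p y / q y) *
        fderiv ℝ (fun y => p y * e y j) y (EuclideanSpace.single j 1) := by
    intro y
    have h1 := (hdyn y).div_const (q y)
    have h2 : HasDerivAt f (f' (p y / q y)) (pt 0 y / q y) := by
      rw [hpt0]; exact hf' _ (hr0 y)
    have h3 := (HasDerivAt.comp (0 : ℝ) h2 h1).const_mul (q y)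
    have h4 := h3.deriv
    simp only [Function.comp_def] at h4
    rw [h4, aux_grad, aux_sum (fderiv ℝ p y) (e y), ← Finset.mul_sum]
    simp only [hgd, Finset.sum_add_distrib, ← Finset.mul_sum]
    have := (hq0 y).ne'
    field_simp
    ring
  have hR : ∀ y, p y * (f'' (p y / q y) * (p y / q y)) *
          ⟪gradient (fun y' => Real.log (p y' / q y')) y, e y⟫ =
      ∑ j, (f'' (p y / q y) • fderiv ℝ (fun y => p y / q y) y)
      (EuclideanSpace.single j 1) * (p y * e y j) := by
    intro y
    have h1 := ((hrd y).log (hr0 y).ne').fderiv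
    rw [aux_grad, h1, ContinuousLinearMap.smul_apply, aux_sum (fderiv ℝ _ y) (e y), smul_eq_mul,
      ← mul_assoc, Finset.mul_sum]
    refine Finset.sum_congr rfl fun j _ => ?_
    rw [ContinuousLinearMap.smul_apply, smul_eq_mul, mul_assoc (p y), mul_assoc (f'' _),
      mul_inv_cancel₀ (hr0 y).ne']
    ring
  have key : ∫ y, deriv (fun t => q y * f (pt t y / q y)) 0 =
      ∫ y, p y * (f'' (p y / q y) * (p y / q y)) *
          ⟪gradient (fun y' => Real.log (p y' / q y')) y, e y⟫ := by
    simp only [hL, hR]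
    rw [integral_neg, integral_finset_sum _ fun j _ => hI2 j,
      integral_finset_sum _ fun j _ => hI1 j, ← Finset.sum_neg_distrib]
    exact Finset.sum_congr rfl fun j _ => by rw [hparts j, neg_neg]
  rw [← key]
  exact hDUI
end

section
/- Let f(r) = −(r+1)·log((1+r)/2) + r·log r for r > 0 (the generator of twice the Jensen–Shannon divergence), and define f̃(u) = u·f(1/u). Then for every r > 0: f''(r)·r = 1/(1+r) and f̃''(1/r)/r = r/(1+r). Equivalently, writing D = log r and σ(t) = 1/(1+e^{−t}), the scaling factors are s_φ = σ(−D) and s_θ = σ(D). -/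
/-- The generator of twice the Jensen–Shannon divergence. -/
noncomputable def f2JS (r : ℝ) : ℝ := -(r + 1) * Real.log ((1 + r) / 2) + r * Real.log r

theorem f2JS_deriv (r : ℝ) (hr : 0 < r) :
    HasDerivAt f2JS (-Real.log ((1 + r) / 2) + Real.log r) r := by
  have h1 : HasDerivAt (fun x : ℝ => (1 + x) / 2) (1 / 2) r :=
    ((hasDerivAt_id r).const_add 1).div_const 2
  have h2 := h1.log (by positivity)
  have h3 : HasDerivAt (fun x : ℝ => -(x + 1)) (-1) r := ((hasDerivAt_id r).add_const 1).neg
  have h4 := (h3.mul h2).add ((hasDerivAt_id r).mul (Real.hasDerivAt_log hr.ne'))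
  refine HasDerivAt.congr_deriv (f := f2JS) h4 ?_
  simp only [id]
  have : 1 + r ≠ 0 := by positivity
  have := hr.ne'
  field_simp
  ring

theorem f2JS_deriv2 (r : ℝ) (hr : 0 < r) :
    deriv (deriv f2JS) r * r = 1 / (1 + r) := by
  have he : deriv f2JS =ᶠ[nhds r] fun x => -Real.log ((1 + x) / 2) + Real.log x := by
    filter_upwards [lt_mem_nhds hr] with x hx
    exact (f2JS_deriv x hx).deriv
  have h1 : HasDerivAt (fun x : ℝ => (1 + x) / 2) (1 / 2) r :=
    ((hasDerivAt_id r).const_add 1).div_const 2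
  have h2 : HasDerivAt (fun x => -Real.log ((1 + x) / 2) + Real.log x) _ r :=
    (h1.log (by positivity)).neg.add (Real.hasDerivAt_log hr.ne')
  rw [he.deriv_eq, h2.deriv]
  have : 1 + r ≠ 0 := by positivity
  have := hr.ne'
  field_simp
  ring

theorem ftilde_f2JS (u : ℝ) (hu : 0 < u) : ftilde f2JS u = f2JS u := by
  have h : (1 + 1 / u) / 2 = ((1 + u) / 2) / u := by field_simp; ring
  unfold ftilde f2JS
  rw [h, Real.log_div (by positivity) hu.ne', one_div, Real.log_inv]
  field_simp
  ring

theorem stmt16 :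
    ∀ r : ℝ, 0 < r →
      deriv (deriv f2JS) r * r = 1 / (1 + r) ∧
      deriv (deriv (ftilde f2JS)) (1 / r) / r = r / (1 + r) ∧
      1 / (1 + r) = 1 / (1 + Real.exp (-(-(Real.log r)))) ∧
      r / (1 + r) = 1 / (1 + Real.exp (-(Real.log r))) := by
  intro r hr
  have hr' : 0 < 1 / r := by positivity
  refine ⟨f2JS_deriv2 r hr, ?_, ?_, ?_⟩
  · have he : ftilde f2JS =ᶠ[nhds (1 / r)] f2JS := by
      filter_upwards [lt_mem_nhds hr'] with x hx
      exact ftilde_f2JS x hx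
    rw [he.deriv.deriv_eq, div_eq_mul_one_div, f2JS_deriv2 _ hr']
    field_simp
    ring
  · rw [neg_neg, Real.exp_log hr]
  · rw [Real.exp_neg, Real.exp_log hr]
    field_simp
    ring
end
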